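/- Let μ be a long positive root of Δ. Then the minimal value of l(u) over all u ∈ W with u(θ) = μ equals (ρ, θ∨ − μ∨), and there is a unique element w ∈ W of this minimal length with w(θ) = μ. -/

import Mathlib

open scoped BigOperators

/-- Data of a reduced irreducible crystallographic root system `Δ`, spanning a
`ℚ`-vector space `V` equipped with a Weyl-group-invariant inner product `B`,
together with a chosen system of positive roots `Pos` and the highest root `θ`. -/
structure RootSystemCtx (V : Type*) [AddCommGroup V] [Module ℚ V] where
  /-- the invariant inner product `( , )` -/
  B : V →ₗ[ℚ] V →ₗ[ℚ] ℚ
  B_symm : ∀ x y : V, B x y = B y x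
  B_posdef : ∀ x : V, x ≠ 0 → 0 < B x x
  /-- the set of roots -/
  Δ : Set V
  Δ_finite : Δ.Finite
  Δ_spans : Submodule.span ℚ Δ = ⊤
  zero_notMem_Δ : (0 : V) ∉ Δ
  neg_mem_Δ : ∀ α ∈ Δ, -α ∈ Δ
  reduced : ∀ α ∈ Δ, ∀ c : ℚ, c • α ∈ Δ → c = 1 ∨ c = -1
  crystallographic : ∀ α ∈ Δ, ∀ β ∈ Δ, ∃ n : ℤ, 2 * B α β / B β β = (n : ℚ)
  reflect_mem : ∀ α ∈ Δ, ∀ β ∈ Δ, β - (2 * B β α / B α α) • α ∈ Δ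
  irreducible : ∀ S : Set V, S ⊆ Δ → (∀ α ∈ S, ∀ β ∈ Δ \ S, B α β = 0) → S = ∅ ∨ S = Δ
  /-- the positive roots `Δ⁺` -/
  Pos : Set V
  pos_subset : Pos ⊆ Δ
  mem_pos_or_neg_pos : ∀ α ∈ Δ, α ∈ Pos ∨ -α ∈ Pos
  pos_not_neg : ∀ α ∈ Pos, -α ∉ Pos
  add_pos_mem : ∀ α ∈ Pos, ∀ β ∈ Pos, α + β ∈ Δ → α + β ∈ Pos
  /-- the highest root `θ` -/
  θ : V
  θ_pos : θ ∈ Pos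
  θ_highest : ∀ ν ∈ Δ, θ - ν ∈ AddSubmonoid.closure Pos

namespace RootSystemCtx

variable {V : Type*} [AddCommGroup V] [Module ℚ V] (ctx : RootSystemCtx V)

/-- the simple roots `Π`: indecomposable positive roots -/
def simple : Set V :=
  {α | α ∈ ctx.Pos ∧ ¬∃ β ∈ ctx.Pos, ∃ γ ∈ ctx.Pos, α = β + γ}

/-- `ρ`, the half-sum of all positive roots -/
noncomputable def ρ : V :=
  (1 / 2 : ℚ) • ∑ α ∈ (ctx.Δ_finite.subset ctx.pos_subset).toFinset, α

/-- the coroot `μ∨ = 2μ/(μ,μ)` -/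
noncomputable def coroot (μ : V) : V := (2 / ctx.B μ μ) • μ

/-- `Δ⁺_l`, the long positive roots (roots of the same length as `θ`) -/
def PosLong : Set V := {μ | μ ∈ ctx.Pos ∧ ctx.B μ μ = ctx.B ctx.θ ctx.θ}

/-- `Π_l`, the long simple roots -/
def SimpleLong : Set V := {μ | μ ∈ ctx.simple ∧ ctx.B μ μ = ctx.B ctx.θ ctx.θ}

/-- the dominance order `μ ≼ ν` on the root lattice: `ν - μ` is a nonnegative
integer combination of positive roots -/
def le (μ ν : V) : Prop := ν - μ ∈ AddSubmonoid.closure ctx.Pos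

/-- a (combinatorial) abelian ideal of `Δ⁺` -/
def IsAbelianIdeal (I : Set V) : Prop :=
  I ⊆ ctx.Pos ∧ (∀ μ ∈ I, ∀ ν ∈ I, μ + ν ∉ ctx.Δ) ∧
    ∀ γ ∈ I, ∀ ν ∈ ctx.Pos, γ + ν ∈ ctx.Δ → γ + ν ∈ I

/-- `γ` is a generator of the ideal `I` -/
def IsGenerator (I : Set V) (γ : V) : Prop := γ ∈ I ∧ ∀ α ∈ ctx.Pos, γ - α ∉ I

/-! ### The affine picture: `V̂ = V ⊕ ℚδ ⊕ ℚλ`, modelled as `V × ℚ × ℚ`,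
with `δ = (0,1,0)` and `λ = (0,0,1)`. -/

/-- the embedding of `V` into `V̂` -/
def emb (_ctx : RootSystemCtx V) (v : V) : V × ℚ × ℚ := (v, 0, 0)

/-- the imaginary root `δ` -/
def δhat (_ctx : RootSystemCtx V) : V × ℚ × ℚ := (0, 1, 0)

/-- the affine simple root `α₀ = δ - θ` -/
def alpha0 : V × ℚ × ℚ := (-ctx.θ, 1, 0)

/-- the extension of the inner product to `V̂`, with
`(δ,V)=(λ,V)=(δ,δ)=(λ,λ)=0` and `(δ,λ)=1` -/
noncomputable def Bhat : (V × ℚ × ℚ) →ₗ[ℚ] (V × ℚ × ℚ) →ₗ[ℚ] ℚ :=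
  LinearMap.mk₂ ℚ (fun x y => ctx.B x.1 y.1 + x.2.1 * y.2.2 + x.2.2 * y.2.1)
    (fun x x' y => by
      simp only [Prod.fst_add, Prod.snd_add, map_add, LinearMap.add_apply]; ring)
    (fun c x y => by
      simp only [Prod.smul_fst, Prod.smul_snd, map_smul, LinearMap.smul_apply,
        smul_eq_mul]; ring)
    (fun x y y' => by
      simp only [Prod.fst_add, Prod.snd_add, map_add]; ring)
    (fun c x y => by
      simp only [Prod.smul_fst, Prod.smul_snd, map_smul, smul_eq_mul]; ring)

/-- the set `Δ̂` of affine real roots -/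
def Δhat : Set (V × ℚ × ℚ) := {x | ∃ α ∈ ctx.Δ, ∃ k : ℤ, x = (α, (k : ℚ), 0)}

/-- the set `Δ̂⁺` of positive affine roots -/
def PosHat : Set (V × ℚ × ℚ) :=
  {x | ∃ α ∈ ctx.Pos, x = (α, 0, 0)} ∪
    {x | ∃ α ∈ ctx.Δ, ∃ k : ℤ, 1 ≤ k ∧ x = (α, (k : ℚ), 0)}

/-- the set `Π̂ = Π ∪ {α₀}` of affine simple roots -/
def SimpleHat : Set (V × ℚ × ℚ) :=
  {x | ∃ α ∈ ctx.simple, x = (α, (0 : ℚ), (0 : ℚ))} ∪ {ctx.alpha0}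

/-- the reflection `s_β : x ↦ x − (2(x,β)/(β,β))·β` in `V̂` -/
noncomputable def refl (β : V × ℚ × ℚ) : (V × ℚ × ℚ) ≃ₗ[ℚ] (V × ℚ × ℚ) :=
  if h : ctx.Bhat β β = 0 then LinearEquiv.refl ℚ _
  else
    Module.reflection (x := β) (f := (2 / ctx.Bhat β β) • ctx.Bhat β)
      (by simp only [LinearMap.smul_apply, smul_eq_mul]; field_simp)

/-- the affine Weyl group `Ŵ`, generated by the reflections `s_β`, `β ∈ Δ̂` -/
def What : Subgroup ((V × ℚ × ℚ) ≃ₗ[ℚ] (V × ℚ × ℚ)) :=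
  Subgroup.closure {g | ∃ β ∈ ctx.Δhat, g = ctx.refl β}

/-- the finite Weyl group `W`, generated by the reflections `s_α`, `α ∈ Δ`
(identified with a subgroup of `Ŵ`) -/
def Wfin : Subgroup ((V × ℚ × ℚ) ≃ₗ[ℚ] (V × ℚ × ℚ)) :=
  Subgroup.closure {g | ∃ α ∈ ctx.Δ, g = ctx.refl (α, (0 : ℚ), (0 : ℚ))}

/-- `N̂(w) = {β ∈ Δ̂⁺ : w(β) ∈ −Δ̂⁺}` -/
def Nhat (w : (V × ℚ × ℚ) ≃ₗ[ℚ] (V × ℚ × ℚ)) : Set (V × ℚ × ℚ) :=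
  {β | β ∈ ctx.PosHat ∧ -(w β) ∈ ctx.PosHat}

/-- a minuscule element of `Ŵ`: every element of `N̂(w)` has the form `δ - γ`
with `γ ∈ Δ⁺` -/
def IsMinuscule (w : (V × ℚ × ℚ) ≃ₗ[ℚ] (V × ℚ × ℚ)) : Prop :=
  w ∈ ctx.What ∧ ∀ β ∈ ctx.Nhat w, ∃ γ ∈ ctx.Pos, β = ctx.δhat - ctx.emb γ

/-- the abelian ideal `I_w` corresponding to a minuscule element `w` -/
def idealOf (w : (V × ℚ × ℚ) ≃ₗ[ℚ] (V × ℚ × ℚ)) : Set V :=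
  {γ | γ ∈ ctx.Pos ∧ ctx.δhat - ctx.emb γ ∈ ctx.Nhat w}

/-- the ideal `I` has rootlet `τ(I) = μ`, i.e. `I = I_w` for some minuscule `w`
with `w(α₀) + δ = μ` -/
def HasRootlet (I : Set V) (μ : V) : Prop :=
  ∃ w, ctx.IsMinuscule w ∧ ctx.idealOf w = I ∧ w ctx.alpha0 + ctx.δhat = ctx.emb μ

/-- `Ab_μ`, the set of nonempty abelian ideals with rootlet `μ` -/
def AbFiber (μ : V) : Set (Set V) := {I | I.Nonempty ∧ ctx.HasRootlet I μ}

/-- `N(u) = {γ ∈ Δ⁺ : u(γ) ∈ −Δ⁺}` for `u` in the finite Weyl group -/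
def Nfin (w : (V × ℚ × ℚ) ≃ₗ[ℚ] (V × ℚ × ℚ)) : Set V :=
  {γ | γ ∈ ctx.Pos ∧ -(w (ctx.emb γ)) ∈ ctx.PosHat}

/-- the length `l(u) = #N(u)` of an element of the finite Weyl group -/
noncomputable def lenFin (w : (V × ℚ × ℚ) ≃ₗ[ℚ] (V × ℚ × ℚ)) : ℕ :=
  (ctx.Nfin w).ncard

end RootSystemCtx

namespace RootSystemCtx

variable {V : Type*} [AddCommGroup V] [Module ℚ V] (ctx : RootSystemCtx V)

/-! ### Reflections and the Weyl group acting on `V` -/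

lemma ne_zero_of_mem {α : V} (h : α ∈ ctx.Δ) : α ≠ 0 :=
  fun h0 => ctx.zero_notMem_Δ (h0 ▸ h)

lemma B_self_pos {α : V} (h : α ∈ ctx.Δ) : 0 < ctx.B α α :=
  ctx.B_posdef α (ctx.ne_zero_of_mem h)

lemma mem_of_pos {α : V} (h : α ∈ ctx.Pos) : α ∈ ctx.Δ := ctx.pos_subset h

/-- The reflection `s_α` of `V` (the identity when `(α, α) = 0`). -/
noncomputable def reflV (α : V) : V ≃ₗ[ℚ] V :=
  if h : ctx.B α α = 0 then LinearEquiv.refl ℚ _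
  else
    Module.reflection (x := α) (f := (2 / ctx.B α α) • ctx.B α)
      (by simp only [LinearMap.smul_apply, smul_eq_mul]; field_simp)

lemma reflV_apply {α : V} (h : α ∈ ctx.Δ) (v : V) :
    ctx.reflV α v = v - (2 * ctx.B v α / ctx.B α α) • α := by
  have h0 := (ctx.B_self_pos h).ne'
  rw [reflV, dif_neg h0, Module.reflection_apply, LinearMap.smul_apply, smul_eq_mul,
    ctx.B_symm α v]
  congr 2
  ring

lemma reflV_mem {α β : V} (hα : α ∈ ctx.Δ) (hβ : β ∈ ctx.Δ) : ctx.reflV α β ∈ ctx.Δ := by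
  rw [ctx.reflV_apply hα]
  exact ctx.reflect_mem α hα β hβ

lemma reflV_reflV {α : V} (h : α ∈ ctx.Δ) (v : V) : ctx.reflV α (ctx.reflV α v) = v := by
  have h0 := (ctx.B_self_pos h).ne'
  rw [ctx.reflV_apply h, ctx.reflV_apply h]
  simp only [map_sub, map_smul, LinearMap.sub_apply, LinearMap.smul_apply, smul_eq_mul]
  rw [sub_sub, ← add_smul]
  convert sub_zero v using 2
  convert zero_smul ℚ α using 2
  field_simp
  ring

lemma reflV_self {α : V} (h : α ∈ ctx.Δ) : ctx.reflV α α = -α := by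
  have h0 := (ctx.B_self_pos h).ne'
  rw [ctx.reflV_apply h, mul_div_assoc, div_self h0, mul_one, two_smul]
  abel

lemma reflV_mul_self {α : V} (h : α ∈ ctx.Δ) : ctx.reflV α * ctx.reflV α = 1 :=
  LinearEquiv.ext fun v => ctx.reflV_reflV h v

lemma reflV_neg {α : V} (h : α ∈ ctx.Δ) : ctx.reflV (-α) = ctx.reflV α := by
  refine LinearEquiv.ext fun v => ?_
  rw [ctx.reflV_apply h, ctx.reflV_apply (ctx.neg_mem_Δ α h)]
  simp only [map_neg, LinearMap.neg_apply, neg_neg, smul_neg, mul_neg, neg_div, neg_smul]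

lemma B_reflV {α : V} (h : α ∈ ctx.Δ) (x y : V) :
    ctx.B (ctx.reflV α x) (ctx.reflV α y) = ctx.B x y := by
  have h0 := (ctx.B_self_pos h).ne'
  rw [ctx.reflV_apply h, ctx.reflV_apply h]
  simp only [map_sub, map_smul, LinearMap.sub_apply, LinearMap.smul_apply, smul_eq_mul]
  rw [ctx.B_symm α y]
  field_simp
  ring

/-- The Weyl group as a group of automorphisms of `V`. -/
def weyl : Subgroup (V ≃ₗ[ℚ] V) :=
  Subgroup.closure {g | ∃ α ∈ ctx.Δ, g = ctx.reflV α}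

lemma reflV_mem_weyl {α : V} (h : α ∈ ctx.Δ) : ctx.reflV α ∈ ctx.weyl :=
  Subgroup.subset_closure ⟨α, h, rfl⟩

lemma inv_apply_apply (u : V ≃ₗ[ℚ] V) (x : V) : u⁻¹ (u x) = x := u.symm_apply_apply x

lemma apply_inv_apply (u : V ≃ₗ[ℚ] V) (x : V) : u (u⁻¹ x) = x := u.apply_symm_apply x

lemma B_weyl {w : V ≃ₗ[ℚ] V} (hw : w ∈ ctx.weyl) (x y : V) :
    ctx.B (w x) (w y) = ctx.B x y := by
  induction hw using Subgroup.closure_induction generalizing x y with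
  | mem g hg => obtain ⟨α, hα, rfl⟩ := hg; exact ctx.B_reflV hα x y
  | one => rfl
  | mul a b _ _ iha ihb => rw [LinearEquiv.mul_apply, LinearEquiv.mul_apply, iha, ihb]
  | inv a _ ih =>
    rw [← ih (a⁻¹ x) (a⁻¹ y), apply_inv_apply, apply_inv_apply]

lemma weyl_mem_iff {w : V ≃ₗ[ℚ] V} (hw : w ∈ ctx.weyl) (x : V) :
    w x ∈ ctx.Δ ↔ x ∈ ctx.Δ := by
  induction hw using Subgroup.closure_induction generalizing x with
  | mem g hg =>
    obtain ⟨α, hα, rfl⟩ := hg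
    refine ⟨fun h => ?_, ctx.reflV_mem hα⟩
    rw [← ctx.reflV_reflV hα x]
    exact ctx.reflV_mem hα h
  | one => rfl
  | mul a b _ _ iha ihb => rw [LinearEquiv.mul_apply, iha, ihb]
  | inv a _ ih =>
    rw [← ih (a⁻¹ x), apply_inv_apply]

lemma reflV_weyl_mul {w : V ≃ₗ[ℚ] V} (hw : w ∈ ctx.weyl) {α : V} (hα : α ∈ ctx.Δ) :
    ctx.reflV (w α) * w = w * ctx.reflV α := by
  refine LinearEquiv.ext fun v => ?_
  rw [LinearEquiv.mul_apply, LinearEquiv.mul_apply,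
    ctx.reflV_apply ((ctx.weyl_mem_iff hw α).2 hα), ctx.reflV_apply hα, ctx.B_weyl hw,
    ctx.B_weyl hw, map_sub, map_smul]

/-! ### Positive roots and `ρ` -/

lemma exists_int_pairing {α β : V} (hα : α ∈ ctx.Δ) (hβ : β ∈ ctx.Δ) :
    ∃ n : ℤ, 2 * ctx.B α β = n * ctx.B β β := by
  obtain ⟨n, hn⟩ := ctx.crystallographic α hα β hβ
  exact ⟨n, by rw [← hn, div_mul_cancel₀ _ (ctx.B_self_pos hβ).ne']⟩

lemma reflV_eq_of_pairing {α v : V} (hα : α ∈ ctx.Δ) {q : ℚ}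
    (h : 2 * ctx.B v α = q * ctx.B α α) : ctx.reflV α v = v - q • α := by
  rw [ctx.reflV_apply hα, h, mul_div_cancel_right₀ _ (ctx.B_self_pos hα).ne']

lemma add_mem_of_B_neg {α β : V} (hα : α ∈ ctx.Δ) (hβ : β ∈ ctx.Δ) (h : ctx.B α β < 0)
    (hne : α + β ≠ 0) : α + β ∈ ctx.Δ := by
  obtain ⟨n, hn⟩ := ctx.exists_int_pairing hα hβ
  obtain ⟨m, hm⟩ := ctx.exists_int_pairing hβ hα
  have h1 := ctx.B_self_pos hα
  have h2 := ctx.B_self_pos hβ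
  have h3 := ctx.B_symm α β
  have hn0 : n < 0 := by
    have : (n : ℚ) < 0 := by
      by_contra hc
      push Not at hc
      nlinarith [mul_nonneg hc h2.le]
    exact_mod_cast this
  have hm0 : m < 0 := by
    have : (m : ℚ) < 0 := by
      by_contra hc
      push Not at hc
      nlinarith [mul_nonneg hc h1.le]
    exact_mod_cast this
  by_cases hn1 : n = -1
  · have := ctx.reflV_eq_of_pairing hβ hn
    rw [hn1] at this
    simp only [Int.cast_neg, Int.cast_one, neg_smul, one_smul, sub_neg_eq_add] at this
    exact this ▸ ctx.reflV_mem hβ hα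
  by_cases hm1 : m = -1
  · have := ctx.reflV_eq_of_pairing hα hm
    rw [hm1] at this
    simp only [Int.cast_neg, Int.cast_one, neg_smul, one_smul, sub_neg_eq_add] at this
    rw [add_comm]
    exact this ▸ ctx.reflV_mem hα hβ
  exfalso
  have hn2 : (n : ℚ) ≤ -2 := by exact_mod_cast (by omega : n ≤ -2)
  have hm2 : (m : ℚ) ≤ -2 := by exact_mod_cast (by omega : m ≤ -2)
  have h4 := ctx.B_posdef _ hne
  simp only [map_add, LinearMap.add_apply] at h4
  nlinarith [mul_le_mul_of_nonneg_right hn2 h2.le, mul_le_mul_of_nonneg_right hm2 h1.le]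

lemma sub_mem_of_B_pos {α β : V} (hα : α ∈ ctx.Δ) (hβ : β ∈ ctx.Δ) (h : 0 < ctx.B α β)
    (hne : α ≠ β) : α - β ∈ ctx.Δ := by
  rw [sub_eq_add_neg]
  refine ctx.add_mem_of_B_neg hα (ctx.neg_mem_Δ β hβ) (by simpa using h) ?_
  rwa [← sub_eq_add_neg, sub_ne_zero]

lemma add_ne_zero_of_pos {α β : V} (hα : α ∈ ctx.Pos) (hβ : β ∈ ctx.Pos) : α + β ≠ 0 :=
  fun h => ctx.pos_not_neg α hα (by rwa [neg_eq_of_add_eq_zero_right h])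

lemma neg_mem_pos_of_notMem {α : V} (h : α ∈ ctx.Δ) (hn : α ∉ ctx.Pos) : -α ∈ ctx.Pos :=
  (ctx.mem_pos_or_neg_pos α h).resolve_left hn

lemma reflV_pos_of_B_nonpos {β γ : V} (hβ : β ∈ ctx.Pos) (hγ : γ ∈ ctx.Pos)
    (h : ctx.B β γ ≤ 0) : ctx.reflV γ β ∈ ctx.Pos := by
  have hγΔ := ctx.mem_of_pos hγ
  have h2 := ctx.B_self_pos hγΔ
  obtain ⟨m, hm⟩ := ctx.exists_int_pairing (ctx.mem_of_pos hβ) hγΔ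
  have hm0 : m ≤ 0 := by
    have : (m : ℚ) ≤ 0 := by
      by_contra hc
      push Not at hc
      nlinarith [mul_pos hc h2]
    exact_mod_cast this
  obtain ⟨n, rfl⟩ : ∃ n : ℕ, m = -(n : ℤ) := ⟨m.natAbs, by omega⟩
  clear h hm0
  induction n using Nat.strong_induction_on generalizing β with
  | _ n ih =>
    have hβΔ := ctx.mem_of_pos hβ
    have hs := ctx.reflV_eq_of_pairing hγΔ hm
    have hsΔ := ctx.reflV_mem hγΔ hβΔ
    push_cast at hm hs
    rcases n with _ | n
    · rw [hs]
      simpa using hβ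
    have hneg : ctx.B β γ < 0 := by
      push_cast at hm
      nlinarith [mul_nonneg (Nat.cast_nonneg (α := ℚ) n) h2.le]
    have hadd := ctx.add_pos_mem β hβ γ hγ
      (ctx.add_mem_of_B_neg hβΔ hγΔ hneg (ctx.add_ne_zero_of_pos hβ hγ))
    rcases n with _ | n
    · rw [hs]
      simpa using hadd
    have key : ctx.reflV γ (β + γ) ∈ ctx.Pos := by
      refine ih n (by omega) hadd ?_
      simp only [map_add, LinearMap.add_apply]
      push_cast at hm ⊢
      linarith
    have heq : ctx.reflV γ β = ctx.reflV γ (β + γ) + γ := by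
      rw [map_add, ctx.reflV_self hγΔ]
      abel
    rw [heq] at hsΔ ⊢
    exact ctx.add_pos_mem _ key _ hγ hsΔ

/-- The finite set of positive roots. -/
noncomputable def posFinset : Finset V := (ctx.Δ_finite.subset ctx.pos_subset).toFinset

lemma mem_posFinset {α : V} : α ∈ ctx.posFinset ↔ α ∈ ctx.Pos := by
  simp [posFinset]

lemma two_mul_B_rho (x : V) : 2 * ctx.B ctx.ρ x = ∑ β ∈ ctx.posFinset, ctx.B β x := by
  simp only [ρ, map_smul, map_sum, LinearMap.smul_apply, LinearMap.sum_apply, smul_eq_mul,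
    posFinset]
  ring

open Classical in
lemma B_rho_pos {γ : V} (hγ : γ ∈ ctx.Pos) : 0 < ctx.B ctx.ρ γ := by
  have hγΔ := ctx.mem_of_pos hγ
  have h1 := ctx.two_mul_B_rho γ
  rw [← Finset.sum_filter_add_sum_filter_not ctx.posFinset (fun β => ctx.reflV γ β ∈ ctx.Pos)]
    at h1
  have h2 : ∑ β ∈ ctx.posFinset with ctx.reflV γ β ∈ ctx.Pos, ctx.B β γ =
      ∑ β ∈ ctx.posFinset with ctx.reflV γ β ∈ ctx.Pos, -ctx.B β γ := by
    refine Finset.sum_nbij' (ctx.reflV γ) (ctx.reflV γ) ?_ ?_ ?_ ?_ ?_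
    · intro β hβ
      simp only [Finset.mem_filter, mem_posFinset] at hβ ⊢
      rw [ctx.reflV_reflV hγΔ]
      exact hβ.symm
    · intro β hβ
      simp only [Finset.mem_filter, mem_posFinset] at hβ ⊢
      rw [ctx.reflV_reflV hγΔ]
      exact hβ.symm
    · exact fun β _ => ctx.reflV_reflV hγΔ β
    · exact fun β _ => ctx.reflV_reflV hγΔ β
    · intro β _
      have := ctx.B_reflV hγΔ β γ
      rw [ctx.reflV_self hγΔ, map_neg] at this
      exact this.symm
  rw [Finset.sum_neg_distrib] at h2
  have h3 : 0 < ∑ β ∈ ctx.posFinset with ctx.reflV γ β ∉ ctx.Pos, ctx.B β γ := by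
    refine Finset.sum_pos ?_ ⟨γ, ?_⟩
    · intro β hβ
      simp only [Finset.mem_filter, mem_posFinset] at hβ
      by_contra hc
      exact hβ.2 (ctx.reflV_pos_of_B_nonpos hβ.1 hγ (not_lt.1 hc))
    · simp only [Finset.mem_filter, mem_posFinset]
      rw [ctx.reflV_self hγΔ]
      exact ⟨hγ, ctx.pos_not_neg γ hγ⟩
  linarith

lemma eq_zero_or_B_rho_pos {x : V} (hx : x ∈ AddSubmonoid.closure ctx.Pos) :
    x = 0 ∨ 0 < ctx.B ctx.ρ x := by
  induction hx using AddSubmonoid.closure_induction with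
  | mem x hx => exact Or.inr (ctx.B_rho_pos hx)
  | zero => exact Or.inl rfl
  | add x y _ _ ihx ihy =>
    rw [map_add]
    rcases ihx with rfl | hx <;> rcases ihy with rfl | hy
    · exact Or.inl (add_zero 0)
    · exact Or.inr (by simpa using hy)
    · exact Or.inr (by simpa using hx)
    · exact Or.inr (add_pos hx hy)

lemma B_nonneg_of_closure {x y : V} (hx : x ∈ AddSubmonoid.closure ctx.Pos)
    (hy : ∀ γ ∈ ctx.Pos, 0 ≤ ctx.B y γ) : 0 ≤ ctx.B y x := by
  induction hx using AddSubmonoid.closure_induction with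
  | mem x hx => exact hy x hx
  | zero => simp
  | add x z _ _ ihx ihz => rw [map_add]; exact add_nonneg ihx ihz

lemma B_rho_nonneg_of_closure {x : V} (hx : x ∈ AddSubmonoid.closure ctx.Pos) :
    0 ≤ ctx.B ctx.ρ x :=
  ctx.B_nonneg_of_closure hx fun _ h => (ctx.B_rho_pos h).le

/-! ### The highest root -/

lemma theta_mem : ctx.θ ∈ ctx.Δ := ctx.mem_of_pos ctx.θ_pos

lemma B_theta_nonneg {γ : V} (hγ : γ ∈ ctx.Pos) : 0 ≤ ctx.B ctx.θ γ := by
  have hγΔ := ctx.mem_of_pos hγ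
  have h := ctx.B_rho_nonneg_of_closure (ctx.θ_highest _ (ctx.reflV_mem hγΔ ctx.theta_mem))
  rw [ctx.reflV_apply hγΔ, sub_sub_cancel, map_smul, smul_eq_mul] at h
  have h1 := nonneg_of_mul_nonneg_left h (ctx.B_rho_pos hγ)
  have h2 := mul_nonneg h1 (ctx.B_self_pos hγΔ).le
  rw [div_mul_cancel₀ _ (ctx.B_self_pos hγΔ).ne'] at h2
  linarith

lemma pairing_theta_eq_one {γ : V} (hγ : γ ∈ ctx.Pos) (hne : γ ≠ ctx.θ)
    (h0 : ctx.B γ ctx.θ ≠ 0) : 2 * ctx.B γ ctx.θ = ctx.B ctx.θ ctx.θ := by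
  have hγΔ := ctx.mem_of_pos hγ
  have hθ := ctx.B_self_pos ctx.theta_mem
  obtain ⟨k, hk⟩ := ctx.exists_int_pairing hγΔ ctx.theta_mem
  have hpos : 0 < ctx.B γ ctx.θ :=
    lt_of_le_of_ne (by rw [ctx.B_symm]; exact ctx.B_theta_nonneg hγ) h0.symm
  have hk0 : 0 < k := by
    have : (0 : ℚ) < k := by
      by_contra hc
      push Not at hc
      nlinarith [mul_nonpos_of_nonpos_of_nonneg hc hθ.le]
    exact_mod_cast this
  by_cases hk1 : k = 1
  · rw [hk, hk1]
    simp
  exfalso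
  have hk2 : (2 : ℚ) ≤ k := by exact_mod_cast (by omega : 2 ≤ k)
  have h1 := ctx.reflV_mem ctx.theta_mem hγΔ
  have h2 := ctx.B_rho_nonneg_of_closure (ctx.θ_highest _ (ctx.neg_mem_Δ _ h1))
  rw [ctx.reflV_eq_of_pairing ctx.theta_mem hk] at h2
  simp only [map_sub, map_neg, map_smul, smul_eq_mul] at h2
  have hρ := ctx.B_rho_pos ctx.θ_pos
  rcases ctx.eq_zero_or_B_rho_pos (ctx.θ_highest γ hγΔ) with h3 | h3
  · exact hne (sub_eq_zero.1 h3).symm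
  · rw [map_sub] at h3
    nlinarith [mul_le_mul_of_nonneg_right hk2 hρ.le]

/-! ### Inversions and the length formula -/

/-- The inversion set of an automorphism of `V`. -/
def inversions (u : V ≃ₗ[ℚ] V) : Set V := {γ | γ ∈ ctx.Pos ∧ -(u γ) ∈ ctx.Pos}

lemma inversions_finite (u : V ≃ₗ[ℚ] V) : (ctx.inversions u).Finite :=
  ctx.Δ_finite.subset fun _ h => ctx.mem_of_pos h.1

open Classical in
lemma sum_B_weyl {u : V ≃ₗ[ℚ] V} (hu : u ∈ ctx.weyl) (x : V) :
    ∑ γ ∈ ctx.posFinset, ctx.B γ (u x) =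
      ∑ γ ∈ ctx.posFinset, (if -(u γ) ∈ ctx.Pos then -1 else 1) * ctx.B γ x := by
  have aux : ∀ {w : V ≃ₗ[ℚ] V}, w ∈ ctx.weyl → ∀ γ ∈ ctx.Pos,
      (if -(w γ) ∈ ctx.Pos then -(w γ) else w γ) ∈ ctx.Pos := by
    intro w hw γ hγ
    split_ifs with h
    · exact h
    · exact (ctx.mem_pos_or_neg_pos _
        ((ctx.weyl_mem_iff hw γ).2 (ctx.mem_of_pos hγ))).resolve_right h
  symm
  refine Finset.sum_nbij' (fun γ => if -(u γ) ∈ ctx.Pos then -(u γ) else u γ)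
    (fun γ => if -(u⁻¹ γ) ∈ ctx.Pos then -(u⁻¹ γ) else u⁻¹ γ) ?_ ?_ ?_ ?_ ?_
  · intro γ hγ
    rw [mem_posFinset] at hγ ⊢
    exact aux hu γ hγ
  · intro γ hγ
    rw [mem_posFinset] at hγ ⊢
    exact aux (ctx.weyl.inv_mem hu) γ hγ
  · intro γ hγ
    rw [mem_posFinset] at hγ
    have := ctx.pos_not_neg γ hγ
    by_cases h : -(u γ) ∈ ctx.Pos <;>
      simp only [h, hγ, this, if_true, if_false, map_neg, neg_neg, inv_apply_apply]
  · intro γ hγ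
    rw [mem_posFinset] at hγ
    have := ctx.pos_not_neg γ hγ
    by_cases h : -(u⁻¹ γ) ∈ ctx.Pos <;>
      simp only [h, hγ, this, if_true, if_false, map_neg, neg_neg, apply_inv_apply]
  · intro γ _
    rw [← ctx.B_weyl hu γ x]
    split_ifs <;> simp

lemma theta_notMem_inversions {u : V ≃ₗ[ℚ] V} (h : u ctx.θ ∈ ctx.Pos) :
    ctx.θ ∉ ctx.inversions u := fun hn => ctx.pos_not_neg _ h hn.2

/-- The number `(ρ, θ∨ − μ∨)` counts the inversions not orthogonal to `θ`. -/
lemma B_rho_coroot_sub {u : V ≃ₗ[ℚ] V} (hu : u ∈ ctx.weyl) (h : u ctx.θ ∈ ctx.Pos) :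
    ctx.B ctx.ρ (ctx.coroot ctx.θ - ctx.coroot (u ctx.θ)) =
      ({γ ∈ ctx.inversions u | ctx.B γ ctx.θ ≠ 0}.ncard : ℚ) := by
  classical
  have hθ := ctx.B_self_pos ctx.theta_mem
  have h1 := ctx.two_mul_B_rho ctx.θ
  have h2 := ctx.two_mul_B_rho (u ctx.θ)
  rw [ctx.sum_B_weyl hu] at h2
  have h3 : 2 * ctx.B ctx.ρ ctx.θ - 2 * ctx.B ctx.ρ (u ctx.θ) =
      ∑ γ ∈ ctx.posFinset, if γ ∈ ctx.inversions u ∧ ctx.B γ ctx.θ ≠ 0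
        then ctx.B ctx.θ ctx.θ else 0 := by
    rw [h1, h2, ← Finset.sum_sub_distrib]
    refine Finset.sum_congr rfl fun γ hγ => ?_
    rw [mem_posFinset] at hγ
    by_cases hn : -(u γ) ∈ ctx.Pos
    · have hi : γ ∈ ctx.inversions u := ⟨hγ, hn⟩
      by_cases h0 : ctx.B γ ctx.θ = 0
      · simp [h0]
      · have hne : γ ≠ ctx.θ := fun e => ctx.theta_notMem_inversions h (e ▸ hi)
        rw [if_pos hn, if_pos ⟨hi, h0⟩, ← ctx.pairing_theta_eq_one hγ hne h0]
        ring
    · have hi : γ ∉ ctx.inversions u := fun hi => hn hi.2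
      simp [hn, hi]
  rw [← Finset.sum_filter, Finset.sum_const, nsmul_eq_mul] at h3
  have h4 : {γ ∈ ctx.inversions u | ctx.B γ ctx.θ ≠ 0} =
      ↑(ctx.posFinset.filter fun γ => γ ∈ ctx.inversions u ∧ ctx.B γ ctx.θ ≠ 0) := by
    ext γ
    simp only [Set.mem_ofPred_eq, Finset.coe_filter, mem_posFinset]
    exact ⟨fun hγ => ⟨hγ.1.1, hγ⟩, fun hγ => hγ.2⟩
  rw [h4, Set.ncard_coe_finset, coroot, coroot, ctx.B_weyl hu, map_sub, map_smul, map_smul,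
    smul_eq_mul, smul_eq_mul, ← mul_sub]
  field_simp
  linarith

lemma B_rho_coroot_sub_le {u : V ≃ₗ[ℚ] V} (hu : u ∈ ctx.weyl) (h : u ctx.θ ∈ ctx.Pos) :
    ctx.B ctx.ρ (ctx.coroot ctx.θ - ctx.coroot (u ctx.θ)) ≤ ((ctx.inversions u).ncard : ℚ) := by
  rw [ctx.B_rho_coroot_sub hu h]
  exact Nat.cast_le.2 (Set.ncard_le_ncard (Set.sep_subset _ _) (ctx.inversions_finite u))

lemma ncard_inversions_eq_iff {u : V ≃ₗ[ℚ] V} (hu : u ∈ ctx.weyl) (h : u ctx.θ ∈ ctx.Pos) :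
    ((ctx.inversions u).ncard : ℚ) =
        ctx.B ctx.ρ (ctx.coroot ctx.θ - ctx.coroot (u ctx.θ)) ↔
      ∀ γ ∈ ctx.Pos, ctx.B γ ctx.θ = 0 → u γ ∈ ctx.Pos := by
  rw [ctx.B_rho_coroot_sub hu h, Nat.cast_inj]
  constructor
  · intro hc γ hγ h0
    by_contra hn
    have he := Set.eq_of_subset_of_ncard_le
      (s := {γ ∈ ctx.inversions u | ctx.B γ ctx.θ ≠ 0}) (fun _ h => h.1) hc.le
      (ctx.inversions_finite u)
    have hi : γ ∈ ctx.inversions u :=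
      ⟨hγ, ctx.neg_mem_pos_of_notMem ((ctx.weyl_mem_iff hu γ).2 (ctx.mem_of_pos hγ)) hn⟩
    rw [← he] at hi
    exact hi.2 h0
  · intro hall
    congr 1
    ext γ
    refine ⟨fun hγ => ⟨hγ, fun h0 => ?_⟩, fun hγ => hγ.1⟩
    exact ctx.pos_not_neg _ (hall γ hγ.1 h0) hγ.2

/-! ### Existence -/

lemma exists_max_of_image_finite {ι : Type*} {S : Set ι} (f : ι → ℚ) (hS : S.Nonempty)
    (hf : (f '' S).Finite) : ∃ a ∈ S, ∀ b ∈ S, f b ≤ f a := by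
  obtain ⟨_, ⟨a, ha, rfl⟩, hmax⟩ := Set.exists_max_image (f '' S) id hf (hS.image f)
  exact ⟨a, ha, fun b hb => hmax _ ⟨b, hb, rfl⟩⟩

lemma eq_theta_of_dominant {ν : V} (hν : ν ∈ ctx.Δ) (hl : ctx.B ν ν = ctx.B ctx.θ ctx.θ)
    (hd : ∀ γ ∈ ctx.Pos, 0 ≤ ctx.B ν γ) : ν = ctx.θ := by
  have h1 := ctx.B_nonneg_of_closure (ctx.θ_highest ν hν) hd
  rw [map_sub] at h1
  by_contra hne
  have h3 := ctx.B_posdef _ (sub_ne_zero.2 hne)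
  simp only [map_sub, LinearMap.sub_apply] at h3
  linarith [ctx.B_symm ν ctx.θ]

lemma exists_weyl_apply_theta {μ : V} (hμ : μ ∈ ctx.Δ)
    (hl : ctx.B μ μ = ctx.B ctx.θ ctx.θ) : ∃ u ∈ ctx.weyl, u ctx.θ = μ := by
  obtain ⟨w, hw, hmax⟩ := exists_max_of_image_finite
    (S := (ctx.weyl : Set (V ≃ₗ[ℚ] V))) (fun w => ctx.B ctx.ρ (w μ)) ⟨1, ctx.weyl.one_mem⟩
    ((ctx.Δ_finite.image (ctx.B ctx.ρ)).subset (by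
      rintro _ ⟨w, hw, rfl⟩
      exact ⟨w μ, (ctx.weyl_mem_iff hw μ).2 hμ, rfl⟩))
  have hwμ := (ctx.weyl_mem_iff hw μ).2 hμ
  refine ⟨w⁻¹, ctx.weyl.inv_mem hw, ?_⟩
  rw [← ctx.eq_theta_of_dominant hwμ (by rw [ctx.B_weyl hw, hl]), inv_apply_apply]
  intro γ hγ
  have hγΔ := ctx.mem_of_pos hγ
  by_contra hc
  push Not at hc
  have h1 := hmax _ (ctx.weyl.mul_mem (ctx.reflV_mem_weyl hγΔ) hw)
  simp only [LinearEquiv.mul_apply] at h1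
  rw [ctx.reflV_apply hγΔ, map_sub, map_smul, smul_eq_mul] at h1
  have h2 : 2 * ctx.B (w μ) γ / ctx.B γ γ < 0 :=
    div_neg_of_neg_of_pos (by linarith) (ctx.B_self_pos hγΔ)
  nlinarith [mul_neg_of_neg_of_pos h2 (ctx.B_rho_pos hγ)]

lemma finite_image_B_rho_weyl :
    ((fun u : V ≃ₗ[ℚ] V => ctx.B ctx.ρ (u ctx.ρ)) '' ctx.weyl).Finite := by
  classical
  refine ((Finset.finite_toSet ctx.Δ_finite.toFinset.powerset).image
    (fun S : Finset V => ctx.B ctx.ρ ((1 / 2 : ℚ) • ∑ α ∈ S, α))).subset ?_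
  rintro _ ⟨u, hu, rfl⟩
  refine ⟨ctx.posFinset.image u, ?_, ?_⟩
  · simp only [Finset.mem_coe, Finset.mem_powerset]
    intro x hx
    obtain ⟨γ, hγ, rfl⟩ := Finset.mem_image.1 hx
    rw [Set.Finite.mem_toFinset]
    exact (ctx.weyl_mem_iff hu γ).2 (ctx.mem_of_pos (ctx.mem_posFinset.1 hγ))
  · simp only
    rw [Finset.sum_image (fun a _ b _ h => u.injective h), ← map_sum, ← map_smul]
    rfl

lemma exists_weyl_apply_theta_pos {μ : V} (hμ : μ ∈ ctx.Δ)
    (hl : ctx.B μ μ = ctx.B ctx.θ ctx.θ) :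
    ∃ u ∈ ctx.weyl, u ctx.θ = μ ∧ ∀ γ ∈ ctx.Pos, ctx.B γ ctx.θ = 0 → u γ ∈ ctx.Pos := by
  obtain ⟨u₀, hu₀, hu₀μ⟩ := ctx.exists_weyl_apply_theta hμ hl
  obtain ⟨u, ⟨hu, huμ⟩, hmax⟩ := exists_max_of_image_finite
    (S := {u : V ≃ₗ[ℚ] V | u ∈ ctx.weyl ∧ u ctx.θ = μ}) (fun u => ctx.B ctx.ρ (u ctx.ρ))
    ⟨u₀, hu₀, hu₀μ⟩ (ctx.finite_image_B_rho_weyl.subset (Set.image_mono fun _ h => h.1))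
  refine ⟨u, hu, huμ, fun γ hγ h0 => ?_⟩
  have hγΔ := ctx.mem_of_pos hγ
  by_contra hn
  have hneg := ctx.B_rho_pos
    (ctx.neg_mem_pos_of_notMem ((ctx.weyl_mem_iff hu γ).2 hγΔ) hn)
  have h1 := hmax (u * ctx.reflV γ) ⟨ctx.weyl.mul_mem hu (ctx.reflV_mem_weyl hγΔ), by
    rw [LinearEquiv.mul_apply, ctx.reflV_apply hγΔ, ctx.B_symm, h0]
    simpa using huμ⟩
  simp only [LinearEquiv.mul_apply] at h1
  rw [ctx.reflV_apply hγΔ, map_sub, map_sub, map_smul, map_smul, smul_eq_mul] at h1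
  rw [map_neg] at hneg
  have h2 : 0 < 2 * ctx.B ctx.ρ γ / ctx.B γ γ :=
    div_pos (by linarith [ctx.B_rho_pos hγ]) (ctx.B_self_pos hγΔ)
  nlinarith [mul_pos h2 hneg]

/-! ### Simple reflections and the stabiliser of the positive system -/

lemma simple_mem {α : V} (h : α ∈ ctx.simple) : α ∈ ctx.Δ := ctx.mem_of_pos h.1

lemma sub_simple_pos {α γ : V} (hα : α ∈ ctx.simple) (hγ : γ ∈ ctx.Pos)
    (h : γ - α ∈ ctx.Δ) : γ - α ∈ ctx.Pos := by
  by_contra hn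
  exact hα.2 ⟨γ, hγ, -(γ - α), ctx.neg_mem_pos_of_notMem h hn, by abel⟩

lemma reflV_simple_pos {α γ : V} (hα : α ∈ ctx.simple) (hγ : γ ∈ ctx.Pos) (hne : γ ≠ α) :
    ctx.reflV α γ ∈ ctx.Pos := by
  have hαΔ := ctx.simple_mem hα
  have h2 := ctx.B_self_pos hαΔ
  obtain ⟨m, hm⟩ := ctx.exists_int_pairing (ctx.mem_of_pos hγ) hαΔ
  rcases le_or_gt (ctx.B γ α) 0 with h | h
  · exact ctx.reflV_pos_of_B_nonpos hγ hα.1 h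
  have hm0 : 0 ≤ m := by
    have : (0 : ℚ) ≤ m := by
      by_contra hc
      push Not at hc
      nlinarith [mul_neg_of_neg_of_pos hc h2]
    exact_mod_cast this
  obtain ⟨n, rfl⟩ : ∃ n : ℕ, m = (n : ℤ) := ⟨m.natAbs, by omega⟩
  clear h hm0
  induction n using Nat.strong_induction_on generalizing γ with
  | _ n ih =>
    have hγΔ := ctx.mem_of_pos hγ
    have hs := ctx.reflV_eq_of_pairing hαΔ hm
    have hsΔ := ctx.reflV_mem hαΔ hγΔ
    push_cast at hm hs
    rcases n with _ | n
    · rw [hs]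
      simpa using hγ
    have hpos : 0 < ctx.B γ α := by
      push_cast at hm
      nlinarith [mul_nonneg (Nat.cast_nonneg (α := ℚ) n) h2.le]
    have hsub := ctx.sub_simple_pos hα hγ (ctx.sub_mem_of_B_pos hγΔ hαΔ hpos hne)
    rcases n with _ | n
    · rw [hs]
      simpa using hsub
    have hne' : γ - α ≠ α := by
      intro he
      have hγ2 : γ = (2 : ℚ) • α := by rw [two_smul, ← sub_eq_iff_eq_add, he]
      rw [hγ2] at hγΔ
      rcases ctx.reduced α hαΔ 2 hγΔ with h | h <;> norm_num at h
    have key : ctx.reflV α (γ - α) ∈ ctx.Pos := by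
      refine ih n (by omega) hsub hne' ?_
      simp only [map_sub, LinearMap.sub_apply]
      push_cast at hm ⊢
      linarith
    have heq : ctx.reflV α γ = ctx.reflV α (γ - α) - α := by
      rw [map_sub, ctx.reflV_self hαΔ]
      abel
    rw [heq] at hsΔ ⊢
    exact ctx.sub_simple_pos hα key hsΔ

lemma pos_induction {P : V → Prop} (hs : ∀ α ∈ ctx.simple, P α)
    (ha : ∀ β ∈ ctx.Pos, ∀ γ ∈ ctx.Pos, P β → P γ → P (β + γ)) :
    ∀ γ ∈ ctx.Pos, P γ := by
  by_contra! hc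
  obtain ⟨γ, ⟨hγ, hPγ⟩, hmin⟩ := Set.exists_min_image {γ | γ ∈ ctx.Pos ∧ ¬P γ}
    (ctx.B ctx.ρ) (ctx.Δ_finite.subset fun _ h => ctx.mem_of_pos h.1) hc
  have hns : γ ∉ ctx.simple := fun h => hPγ (hs γ h)
  obtain ⟨β, hβ, δ, hδ, rfl⟩ : ∃ β ∈ ctx.Pos, ∃ δ ∈ ctx.Pos, γ = β + δ := by
    by_contra h
    exact hns ⟨hγ, h⟩
  have h1 := ctx.B_rho_pos hβ
  have h2 := ctx.B_rho_pos hδ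
  rw [map_add] at hmin
  refine hPγ (ha β hβ δ hδ ?_ ?_) <;> by_contra h
  · linarith [hmin β ⟨hβ, h⟩]
  · linarith [hmin δ ⟨hδ, h⟩]

lemma exists_simple_B_pos {ν : V} (hν : ν ∈ ctx.Pos) : ∃ α ∈ ctx.simple, 0 < ctx.B ν α := by
  by_contra! hc
  have := ctx.pos_induction (P := fun γ => ctx.B ν γ ≤ 0) hc
    (fun β _ γ _ h1 h2 => by simp only [map_add]; linarith) ν hν
  exact absurd (ctx.B_self_pos (ctx.mem_of_pos hν)) (not_lt.2 this)

/-- The subgroup generated by the simple reflections. -/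
def simpleWeyl : Subgroup (V ≃ₗ[ℚ] V) :=
  Subgroup.closure {g | ∃ α ∈ ctx.simple, g = ctx.reflV α}

lemma simpleWeyl_le : ctx.simpleWeyl ≤ ctx.weyl :=
  Subgroup.closure_mono fun _ ⟨α, hα, h⟩ => ⟨α, ctx.simple_mem hα, h⟩

lemma exists_simpleWeyl_apply_mem_simple {γ : V} (hγ : γ ∈ ctx.Pos) :
    ∃ w ∈ ctx.simpleWeyl, w γ ∈ ctx.simple := by
  obtain ⟨w, ⟨hw, hwγ⟩, hmax⟩ := exists_max_of_image_finite
    (S := {w : V ≃ₗ[ℚ] V | w ∈ ctx.simpleWeyl ∧ w γ ∈ ctx.Pos})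
    (fun w => -ctx.B ctx.ρ (w γ)) ⟨1, ctx.simpleWeyl.one_mem, hγ⟩
    ((ctx.Δ_finite.image fun x => -ctx.B ctx.ρ x).subset (by
      rintro _ ⟨w, hw, rfl⟩
      exact ⟨w γ, ctx.mem_of_pos hw.2, rfl⟩))
  obtain ⟨α, hα, hpos⟩ := ctx.exists_simple_B_pos hwγ
  have hαΔ := ctx.simple_mem hα
  refine ⟨w, hw, ?_⟩
  suffices w γ = α from this ▸ hα
  by_contra hne
  have h1 := hmax (ctx.reflV α * w)
    ⟨ctx.simpleWeyl.mul_mem (Subgroup.subset_closure ⟨α, hα, rfl⟩) hw,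
      ctx.reflV_simple_pos hα hwγ hne⟩
  simp only [LinearEquiv.mul_apply] at h1
  rw [ctx.reflV_apply hαΔ, map_sub, map_smul, smul_eq_mul] at h1
  have h2 : 0 < 2 * ctx.B (w γ) α / ctx.B α α :=
    div_pos (by linarith) (ctx.B_self_pos hαΔ)
  nlinarith [mul_pos h2 (ctx.B_rho_pos hα.1)]

lemma weyl_eq_simpleWeyl : ctx.weyl = ctx.simpleWeyl := by
  refine le_antisymm ((Subgroup.closure_le _).2 ?_) ctx.simpleWeyl_le
  have key : ∀ γ ∈ ctx.Pos, ctx.reflV γ ∈ ctx.simpleWeyl := by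
    intro γ hγ
    obtain ⟨w, hw, hs⟩ := ctx.exists_simpleWeyl_apply_mem_simple hγ
    have h := ctx.reflV_weyl_mul (ctx.simpleWeyl_le hw) (ctx.mem_of_pos hγ)
    have hr : ctx.reflV (w γ) ∈ ctx.simpleWeyl := Subgroup.subset_closure ⟨_, hs, rfl⟩
    have h' : ctx.reflV γ = w⁻¹ * (ctx.reflV (w γ) * w) := by rw [h, inv_mul_cancel_left]
    rw [h']
    exact mul_mem (inv_mem hw) (mul_mem hr hw)
  rintro _ ⟨α, hα, rfl⟩
  rcases ctx.mem_pos_or_neg_pos α hα with h | h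
  · exact key α h
  · rw [← ctx.reflV_neg hα]
    exact key _ h

/-- The product of the reflections in the members of a list. -/
noncomputable def wordProd (L : List V) : V ≃ₗ[ℚ] V := (L.map ctx.reflV).prod

lemma wordProd_mem {L : List V} (hL : ∀ α ∈ L, α ∈ ctx.simple) :
    ctx.wordProd L ∈ ctx.weyl := by
  refine Subgroup.list_prod_mem _ fun x hx => ?_
  obtain ⟨α, hα, rfl⟩ := List.mem_map.1 hx
  exact ctx.reflV_mem_weyl (ctx.simple_mem (hL α hα))

lemma wordProd_cons (α : V) (L : List V) :
    ctx.wordProd (α :: L) = ctx.reflV α * ctx.wordProd L := by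
  simp [wordProd]

lemma wordProd_append (L L' : List V) :
    ctx.wordProd (L ++ L') = ctx.wordProd L * ctx.wordProd L' := by
  simp [wordProd]

lemma exists_wordProd {w : V ≃ₗ[ℚ] V} (hw : w ∈ ctx.weyl) :
    ∃ L : List V, (∀ α ∈ L, α ∈ ctx.simple) ∧ ctx.wordProd L = w := by
  rw [weyl_eq_simpleWeyl] at hw
  induction hw using Subgroup.closure_induction with
  | mem g hg =>
    obtain ⟨α, hα, rfl⟩ := hg
    exact ⟨[α], by simpa using hα, by simp [wordProd]⟩
  | one => exact ⟨[], by simp, rfl⟩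
  | mul a b _ _ iha ihb =>
    obtain ⟨L, hL, rfl⟩ := iha
    obtain ⟨L', hL', rfl⟩ := ihb
    refine ⟨L ++ L', fun α hα => ?_, ctx.wordProd_append L L'⟩
    exact (List.mem_append.1 hα).elim (hL α) (hL' α)
  | inv a _ ih =>
    obtain ⟨L, hL, rfl⟩ := ih
    refine ⟨L.reverse, fun α hα => hL α (List.mem_reverse.1 hα), ?_⟩
    clear * - hL
    induction L with
    | nil => simp [wordProd]
    | cons α L ih =>
      have hα := ctx.simple_mem (hL α List.mem_cons_self)
      rw [List.reverse_cons, wordProd_append, ih fun β hβ => hL β (List.mem_cons_of_mem _ hβ),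
        ctx.wordProd_cons α L, mul_inv_rev, inv_eq_of_mul_eq_one_left (ctx.reflV_mul_self hα)]
      simp [wordProd]

/-- The exchange property, in the form needed for simple transitivity. -/
lemma exists_shorter_word {L : List V} (hL : ∀ β ∈ L, β ∈ ctx.simple) {α : V}
    (hα : α ∈ ctx.simple) (hneg : -(ctx.wordProd L α) ∈ ctx.Pos) :
    ∃ L' : List V, (∀ β ∈ L', β ∈ ctx.simple) ∧ L'.length + 1 = L.length ∧
      ctx.wordProd L' = ctx.wordProd L * ctx.reflV α := by
  have hαΔ := ctx.simple_mem hα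
  induction L with
  | nil => exact absurd hneg (ctx.pos_not_neg α hα.1)
  | cons β L ih =>
    have hβ := hL β List.mem_cons_self
    have hL' : ∀ γ ∈ L, γ ∈ ctx.simple := fun γ h => hL γ (List.mem_cons_of_mem _ h)
    have hw := ctx.wordProd_mem hL'
    by_cases hp : ctx.wordProd L α ∈ ctx.Pos
    · have he : ctx.wordProd L α = β := by
        by_contra hne
        rw [wordProd_cons] at hneg
        exact ctx.pos_not_neg _ (ctx.reflV_simple_pos hβ hp hne) hneg
      refine ⟨L, hL', rfl, ?_⟩
      rw [wordProd_cons, ← he, ctx.reflV_weyl_mul hw hαΔ, mul_assoc, ctx.reflV_mul_self hαΔ,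
        mul_one]
    · obtain ⟨M, hM, hlen, hprod⟩ := ih hL'
        (ctx.neg_mem_pos_of_notMem ((ctx.weyl_mem_iff hw α).2 hαΔ) hp)
      refine ⟨β :: M, fun γ hγ => ?_, by simp [hlen], by
        rw [wordProd_cons, wordProd_cons, hprod, mul_assoc]⟩
      rcases List.mem_cons.1 hγ with rfl | h
      · exact hβ
      · exact hM γ h

lemma eq_one_of_map_pos {w : V ≃ₗ[ℚ] V} (hw : w ∈ ctx.weyl)
    (h : ∀ γ ∈ ctx.Pos, w γ ∈ ctx.Pos) : w = 1 := by
  obtain ⟨L, hL, rfl⟩ := ctx.exists_wordProd hw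
  induction hn : L.length using Nat.strong_induction_on generalizing L with
  | _ n ih =>
    rcases L.eq_nil_or_concat with rfl | ⟨M, α, rfl⟩
    · rfl
    have hα : α ∈ ctx.simple := hL α (by simp)
    have hM : ∀ β ∈ M, β ∈ ctx.simple := fun β hβ => hL β (by simp [hβ])
    have he : ctx.wordProd (M ++ [α]) = ctx.wordProd M * ctx.reflV α := by
      rw [wordProd_append]
      simp [wordProd]
    simp only [List.concat_eq_append] at *
    have hneg : -(ctx.wordProd M α) ∈ ctx.Pos := by
      have := h α hα.1
      rwa [he, LinearEquiv.mul_apply, ctx.reflV_self (ctx.simple_mem hα), map_neg] at this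
    obtain ⟨L', hL', hlen, hprod⟩ := ctx.exists_shorter_word hM hα hneg
    rw [he, ← hprod] at h hw ⊢
    refine ih L'.length ?_ L' hL' hw h rfl
    simp at hn
    omega

/-! ### Uniqueness -/

lemma weyl_unique {u v : V ≃ₗ[ℚ] V} (hu : u ∈ ctx.weyl) (hv : v ∈ ctx.weyl)
    (he : u ctx.θ = v ctx.θ)
    (hup : ∀ γ ∈ ctx.Pos, ctx.B γ ctx.θ = 0 → u γ ∈ ctx.Pos)
    (hvp : ∀ γ ∈ ctx.Pos, ctx.B γ ctx.θ = 0 → v γ ∈ ctx.Pos) : u = v := by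
  have hw := ctx.weyl.mul_mem (ctx.weyl.inv_mem hv) hu
  have hθ : (v⁻¹ * u) ctx.θ = ctx.θ := by rw [LinearEquiv.mul_apply, he, inv_apply_apply]
  have hB : ∀ γ, ctx.B ((v⁻¹ * u) γ) ctx.θ = ctx.B γ ctx.θ := fun γ => by
    conv_lhs => rw [← hθ]
    exact ctx.B_weyl hw γ ctx.θ
  have h1 : v⁻¹ * u = 1 := by
    refine ctx.eq_one_of_map_pos hw fun γ hγ => ?_
    by_contra hn
    have hneg := ctx.neg_mem_pos_of_notMem
      ((ctx.weyl_mem_iff hw γ).2 (ctx.mem_of_pos hγ)) hn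
    have hle := ctx.B_theta_nonneg hneg
    rw [ctx.B_symm, map_neg, LinearMap.neg_apply, hB] at hle
    have hge := ctx.B_theta_nonneg hγ
    rw [ctx.B_symm] at hge
    have h0 : ctx.B γ ctx.θ = 0 := by linarith
    have h2 := hvp _ hneg (by rw [map_neg, LinearMap.neg_apply, hB, h0, neg_zero])
    rw [map_neg, LinearEquiv.mul_apply, apply_inv_apply] at h2
    exact ctx.pos_not_neg _ (hup γ hγ h0) h2
  exact (inv_mul_eq_one.1 h1).symm

/-! ### Transfer to `V̂` -/

/-- The extension of an automorphism of `V` to `V̂`, trivial on `δ` and `λ`. -/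
def extend : (V ≃ₗ[ℚ] V) →* ((V × ℚ × ℚ) ≃ₗ[ℚ] (V × ℚ × ℚ)) where
  toFun w := LinearEquiv.prodCongr w (LinearEquiv.refl ℚ (ℚ × ℚ))
  map_one' := rfl
  map_mul' _ _ := rfl

lemma extend_apply (w : V ≃ₗ[ℚ] V) (x : V × ℚ × ℚ) : extend w x = (w x.1, x.2) := rfl

lemma refl_eq_extend {α : V} (hα : α ∈ ctx.Δ) :
    ctx.refl (α, (0 : ℚ), (0 : ℚ)) = extend (ctx.reflV α) := by
  have hB : ∀ x : V × ℚ × ℚ, ctx.Bhat (α, (0 : ℚ), (0 : ℚ)) x = ctx.B α x.1 := fun x => by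
    simp [Bhat]
  have h0 : ctx.Bhat (α, (0 : ℚ), (0 : ℚ)) (α, (0 : ℚ), (0 : ℚ)) ≠ 0 := by
    rw [hB]
    exact (ctx.B_self_pos hα).ne'
  refine LinearEquiv.ext fun x => ?_
  rw [refl, dif_neg h0, Module.reflection_apply, LinearMap.smul_apply, hB, hB, extend_apply,
    ctx.reflV_apply hα, ctx.B_symm x.1 α, smul_eq_mul, div_mul_eq_mul_div]
  ext <;> simp

lemma Wfin_eq_map : ctx.Wfin = ctx.weyl.map extend := by
  rw [Wfin, weyl, MonoidHom.map_closure]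
  congr 1
  ext g
  constructor
  · rintro ⟨α, hα, rfl⟩
    exact ⟨_, ⟨α, hα, rfl⟩, (ctx.refl_eq_extend hα).symm⟩
  · rintro ⟨_, ⟨α, hα, rfl⟩, rfl⟩
    exact ⟨α, hα, (ctx.refl_eq_extend hα).symm⟩

lemma lenFin_extend (w : V ≃ₗ[ℚ] V) : ctx.lenFin (extend w) = (ctx.inversions w).ncard := by
  rw [lenFin]
  congr 1
  ext γ
  refine and_congr_right fun _ => ?_
  rw [extend_apply]
  constructor
  · rintro (⟨α, hα, h⟩ | ⟨α, _, k, hk, h⟩)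
    · rw [Prod.ext_iff] at h
      have : -(w γ) = α := h.1
      rwa [this]
    · have h2 : -(0 : ℚ) = k := congrArg (fun x : V × ℚ × ℚ => x.2.1) h
      have h3 : (1 : ℚ) ≤ k := by exact_mod_cast hk
      linarith
  · intro h
    exact Or.inl ⟨_, h, by ext <;> simp [emb]⟩

lemma extend_emb_eq_iff (w : V ≃ₗ[ℚ] V) (x y : V) :
    extend w (ctx.emb x) = ctx.emb y ↔ w x = y := by
  simp [extend_apply, emb]

end RootSystemCtx

/-- Theorem `uniq` 1: the minimal length of `u ∈ W` with
`u(θ) = μ` is `(ρ, θ∨ − μ∨)`, and the element of minimal length is unique. -/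
theorem statement_13 {V : Type*} [AddCommGroup V] [Module ℚ V] (ctx : RootSystemCtx V)
    (μ : V) (hμ : μ ∈ ctx.PosLong) :
    (∀ u ∈ ctx.Wfin, u (ctx.emb ctx.θ) = ctx.emb μ →
        ctx.B ctx.ρ (ctx.coroot ctx.θ - ctx.coroot μ) ≤ (ctx.lenFin u : ℚ)) ∧
    ∃! w : (V × ℚ × ℚ) ≃ₗ[ℚ] (V × ℚ × ℚ), w ∈ ctx.Wfin ∧
      w (ctx.emb ctx.θ) = ctx.emb μ ∧
      (ctx.lenFin w : ℚ) = ctx.B ctx.ρ (ctx.coroot ctx.θ - ctx.coroot μ) := by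
  obtain ⟨hμ, hl⟩ := hμ
  have hμΔ := ctx.mem_of_pos hμ
  rw [ctx.Wfin_eq_map]
  refine ⟨?_, ?_⟩
  · rintro _ ⟨u, hu, rfl⟩ h
    obtain rfl := (ctx.extend_emb_eq_iff u _ _).1 h
    rw [ctx.lenFin_extend]
    exact ctx.B_rho_coroot_sub_le hu hμ
  · obtain ⟨u, hu, rfl, hup⟩ := ctx.exists_weyl_apply_theta_pos hμΔ hl
    refine ⟨RootSystemCtx.extend u,
      ⟨⟨u, hu, rfl⟩, (ctx.extend_emb_eq_iff u _ _).2 rfl, ?_⟩, ?_⟩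
    · rw [ctx.lenFin_extend]
      exact (ctx.ncard_inversions_eq_iff hu hμ).2 hup
    · rintro _ ⟨⟨v, hv, rfl⟩, hvθ, hlen⟩
      replace hvθ := (ctx.extend_emb_eq_iff v _ _).1 hvθ
      rw [ctx.lenFin_extend, ← hvθ] at hlen
      rw [ctx.weyl_unique hv hu hvθ
        ((ctx.ncard_inversions_eq_iff hv (hvθ ▸ hμ)).1 hlen) hup]
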